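/- Let (L₁, ∘¹_λ, ∗¹_λ) and (L₂, ∘²_λ, ∗²_λ) be pre-Lie Poisson conformal superalgebras. Let L = L₁ ⊗_{ℂ[∂]} L₂ with ℤ₂-grading |a₁ ⊗ a₂| = |a₁| + |a₂| and ℂ[∂]-module structure ∂(a ⊗ b) = (∂a) ⊗ b = a ⊗ (∂b). Define, for homogeneous a₁, b₁ ∈ L₁ and a₂, b₂ ∈ L₂: (a₁ ⊗ a₂) ∘_λ (b₁ ⊗ b₂) = (−1)^{|a₂||b₁|} (a₁ ∘¹_λ b₁) ⊗ (a₂ ∘²_λ b₂), and (a₁ ⊗ a₂) ∗_λ (b₁ ⊗ b₂) = (−1)^{|a₂||b₁|} ( (a₁ ∗¹_λ b₁) ⊗ (a₂ ∘²_λ b₂) + (a₁ ∘¹_λ b₁) ⊗ (a₂ ∗²_λ b₂) ). Then (L, ∘_λ, ∗_λ) is a pre-Lie Poisson conformal superalgebra. -/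

import Mathlib

open Polynomial
open scoped TensorProduct

noncomputable section

namespace TPCSAFormal

/-- The super-sign `(-1)^{i·j}` for parities `i, j ∈ ℤ/2ℤ`. -/
def sgn (i j : ZMod 2) : ℂ := (-1 : ℂ) ^ (i.val * j.val)

variable (L : Type*) [AddCommGroup L] [Module ℂ L]
  [Module (Polynomial ℂ) L] [IsScalarTower ℂ (Polynomial ℂ) L]

/-- A conformal `λ`-product on the `ℂ[∂]`-module `L`, recorded by its family of `n`-th
product coefficients: `a ∘_λ b = ∑_n λ^n • coeff n a b`, with finitely many nonzero terms.
This is exactly the data of a `ℂ`-bilinear map `L ⊗ L → ℂ[λ] ⊗ L`. -/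
structure ConformalProduct where
  coeff : ℕ → L →ₗ[ℂ] L →ₗ[ℂ] L
  coeff_finite : ∀ a b : L, ∃ N : ℕ, ∀ n : ℕ, N ≤ n → coeff n a b = 0

variable {L}

/-- The value `a ∘_λ b` of the `λ`-product at `λ ∈ ℂ`.  Since `ℂ` is infinite, identities
between such values for all `λ` are equivalent to the corresponding polynomial identities. -/
def ConformalProduct.mul (m : ConformalProduct L) (lam : ℂ) (a b : L) : L :=
  ∑ᶠ n : ℕ, lam ^ n • m.coeff n a b

/-- The value `a ∘_{-∂-λ} b`, where `∂` acts on `L` as scalar multiplication by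
`X ∈ ℂ[∂]` (the variable `λ` being replaced by the operator `-∂-λ`). -/
def ConformalProduct.cmul (m : ConformalProduct L) (lam : ℂ) (a b : L) : L :=
  ∑ᶠ n : ℕ, ((-((X : Polynomial ℂ) + C lam)) ^ n) • m.coeff n a b

variable (L) in
/-- A `ℤ₂`-grading on `L` making it a `ℤ₂`-graded `ℂ[∂]`-module: `L = L₀ ⊕ L₁` with
`∂ L_i ⊆ L_i`, where `∂` acts as multiplication by `X ∈ ℂ[∂]`. -/
structure SuperModule where
  grade : ZMod 2 → Submodule ℂ L
  isInternal : DirectSum.IsInternal grade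
  X_smul_mem : ∀ (i : ZMod 2) (a : L), a ∈ grade i → (X : Polynomial ℂ) • a ∈ grade i

/-- `m` is an even `λ`-product on the `ℤ₂`-graded `ℂ[∂]`-module `(L, S)`:
it is even with respect to the grading and conformally sesquilinear. -/
structure IsLambdaProduct (S : SuperModule L) (m : ConformalProduct L) : Prop where
  even : ∀ (i j : ZMod 2) (a b : L), a ∈ S.grade i → b ∈ S.grade j →
    ∀ n : ℕ, m.coeff n a b ∈ S.grade (i + j)
  sesq_left : ∀ (lam : ℂ) (a b : L),
    m.mul lam ((X : Polynomial ℂ) • a) b = (-lam) • m.mul lam a b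
  sesq_right : ∀ (lam : ℂ) (a b : L),
    m.mul lam a ((X : Polynomial ℂ) • b) =
      (X : Polynomial ℂ) • m.mul lam a b + lam • m.mul lam a b

/-- `(L, S, m)` is a commutative associative conformal superalgebra. -/
structure IsCommAssoc (S : SuperModule L) (m : ConformalProduct L)
    extends IsLambdaProduct S m : Prop where
  comm : ∀ (i j : ZMod 2) (a b : L), a ∈ S.grade i → b ∈ S.grade j →
    ∀ lam : ℂ, m.mul lam a b = sgn i j • m.cmul lam b a
  assoc : ∀ (lam mu : ℂ) (a b c : L),
    m.mul lam a (m.mul mu b c) = m.mul (lam + mu) (m.mul lam a b) c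

/-- `(L, S, br)` is a Lie conformal superalgebra. -/
structure IsLie (S : SuperModule L) (br : ConformalProduct L)
    extends IsLambdaProduct S br : Prop where
  skew : ∀ (i j : ZMod 2) (a b : L), a ∈ S.grade i → b ∈ S.grade j →
    ∀ lam : ℂ, br.mul lam a b = -(sgn i j • br.cmul lam b a)
  jacobi : ∀ (i j : ZMod 2) (a b : L), a ∈ S.grade i → b ∈ S.grade j →
    ∀ (c : L) (lam mu : ℂ),
      br.mul lam a (br.mul mu b c) =
        br.mul (lam + mu) (br.mul lam a b) c + sgn i j • br.mul mu b (br.mul lam a c)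

/-- `(L, S, m, br)` is a transposed Poisson conformal superalgebra. -/
structure IsTPCSA (S : SuperModule L) (m br : ConformalProduct L) : Prop where
  commAssoc : IsCommAssoc S m
  lie : IsLie S br
  transposedLeibniz : ∀ (i j : ZMod 2) (a b : L), a ∈ S.grade i → b ∈ S.grade j →
    ∀ (c : L) (lam mu : ℂ),
      (2 : ℂ) • m.mul lam a (br.mul mu b c) =
        br.mul (lam + mu) (m.mul lam a b) c + sgn i j • br.mul mu b (m.mul lam a c)

/-- `(L, S, m, br)` is a Poisson conformal superalgebra. -/
structure IsPCSA (S : SuperModule L) (m br : ConformalProduct L) : Prop where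
  commAssoc : IsCommAssoc S m
  lie : IsLie S br
  leibniz : ∀ (i j : ZMod 2) (a b : L), a ∈ S.grade i → b ∈ S.grade j →
    ∀ (c : L) (lam mu : ℂ),
      br.mul lam a (m.mul mu b c) =
        m.mul (lam + mu) (br.mul lam a b) c + sgn i j • m.mul mu b (br.mul lam a c)

/-- `(L, S, br, α)` is a Hom-Lie conformal superalgebra. -/
structure IsHomLie (S : SuperModule L) (br : ConformalProduct L) (α : L → L)
    extends IsLambdaProduct S br : Prop where
  map_smul_add : ∀ (c : ℂ) (a b : L), α (c • a + b) = c • α a + α b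
  map_grade : ∀ (i : ZMod 2) (a : L), a ∈ S.grade i → α a ∈ S.grade i
  commute_partial : ∀ a : L, α ((X : Polynomial ℂ) • a) = (X : Polynomial ℂ) • α a
  skew : ∀ (i j : ZMod 2) (a b : L), a ∈ S.grade i → b ∈ S.grade j →
    ∀ lam : ℂ, br.mul lam a b = -(sgn i j • br.cmul lam b a)
  homJacobi : ∀ (i j : ZMod 2) (a b : L), a ∈ S.grade i → b ∈ S.grade j →
    ∀ (c : L) (lam mu : ℂ),
      br.mul lam (α a) (br.mul mu b c) =
        br.mul (lam + mu) (br.mul lam a b) (α c) + sgn i j • br.mul mu (α b) (br.mul lam a c)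

/-- `(L, S, p)` is a left-symmetric conformal superalgebra. -/
structure IsLeftSymmetric (S : SuperModule L) (p : ConformalProduct L)
    extends IsLambdaProduct S p : Prop where
  leftSym : ∀ (i j : ZMod 2) (a b : L), a ∈ S.grade i → b ∈ S.grade j →
    ∀ (c : L) (lam mu : ℂ),
      p.mul (lam + mu) (p.mul lam a b) c - p.mul lam a (p.mul mu b c) =
        sgn i j • (p.mul (lam + mu) (p.mul mu b a) c - p.mul mu b (p.mul lam a c))

/-- `(L, S, p)` is a (left) Novikov conformal superalgebra. -/
structure IsNovikov (S : SuperModule L) (p : ConformalProduct L)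
    extends IsLeftSymmetric S p : Prop where
  novikov : ∀ (j k : ZMod 2) (b c : L), b ∈ S.grade j → c ∈ S.grade k →
    ∀ (a : L) (lam mu : ℂ),
      p.mul (lam + mu) (p.mul lam a b) c = sgn j k • p.cmul mu (p.mul lam a c) b

/-- `(L, S, mc, p)` is a Novikov-Poisson conformal superalgebra. -/
structure IsNovikovPoisson (S : SuperModule L) (mc p : ConformalProduct L) : Prop where
  commAssoc : IsCommAssoc S mc
  novikov : IsNovikov S p
  compat₁ : ∀ (lam mu : ℂ) (a b c : L),
    p.mul (lam + mu) (mc.mul lam a b) c = mc.mul lam a (p.mul mu b c)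
  compat₂ : ∀ (i j : ZMod 2) (a b : L), a ∈ S.grade i → b ∈ S.grade j →
    ∀ (c : L) (lam mu : ℂ),
      mc.mul (lam + mu) (p.mul lam a b) c - p.mul lam a (mc.mul mu b c) =
        sgn i j • (mc.mul (lam + mu) (p.mul mu b a) c - p.mul mu b (mc.mul lam a c))

/-- `(L, S, mc, p)` is a pre-Lie commutative conformal superalgebra. -/
structure IsPreLieComm (S : SuperModule L) (mc p : ConformalProduct L) : Prop where
  commAssoc : IsCommAssoc S mc
  leftSymmetric : IsLeftSymmetric S p
  compat : ∀ (i j : ZMod 2) (a b : L), a ∈ S.grade i → b ∈ S.grade j →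
    ∀ (c : L) (lam mu : ℂ),
      p.mul lam a (mc.mul mu b c) =
        mc.mul (lam + mu) (p.mul lam a b) c + sgn i j • mc.mul mu b (p.mul lam a c)

/-- `(L, S, mc, p)` is a pre-Lie Poisson conformal superalgebra. -/
structure IsPreLiePoisson (S : SuperModule L) (mc p : ConformalProduct L) : Prop where
  commAssoc : IsCommAssoc S mc
  leftSymmetric : IsLeftSymmetric S p
  compat₁ : ∀ (lam mu : ℂ) (a b c : L),
    p.mul (lam + mu) (mc.mul lam a b) c = mc.mul lam a (p.mul mu b c)
  compat₂ : ∀ (i j : ZMod 2) (a b : L), a ∈ S.grade i → b ∈ S.grade j →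
    ∀ (c : L) (lam mu : ℂ),
      mc.mul (lam + mu) (p.mul lam a b) c - p.mul lam a (mc.mul mu b c) =
        sgn i j • (mc.mul (lam + mu) (p.mul mu b a) c - p.mul mu b (mc.mul lam a c))

section PolynomialLinearity

variable {M N P : Type*} [AddCommGroup M] [Module ℂ M] [Module ℂ[X] M] [IsScalarTower ℂ ℂ[X] M]
  [AddCommGroup N] [Module ℂ N] [Module ℂ[X] N] [IsScalarTower ℂ ℂ[X] N]
  [AddCommGroup P] [Module ℂ P]

lemma C_smul_eq_smul (c : ℂ) (x : M) : (C c : ℂ[X]) • x = c • x := by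
  rw [← Polynomial.algebraMap_eq, algebraMap_smul]

/-- The action of a polynomial, as a `ℂ`-linear map. -/
def smulLin (r : ℂ[X]) : M →ₗ[ℂ] M := (LinearMap.lsmul ℂ[X] M r).restrictScalars ℂ

@[simp]
lemma smulLin_apply (r : ℂ[X]) (x : M) : smulLin r x = r • x := rfl

lemma balanced_of_X (f : M →ₗ[ℂ] N →ₗ[ℂ] P)
    (hf : ∀ a b, f ((X : ℂ[X]) • a) b = f a ((X : ℂ[X]) • b)) (r : ℂ[X]) (a : M) (b : N) :
    f (r • a) b = f a (r • b) := by
  induction r using Polynomial.induction_on generalizing a b with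
  | C c => simp [C_smul_eq_smul]
  | add p q hp hq => simp [add_smul, hp, hq]
  | monomial n c ih => rw [pow_succ, ← mul_assoc, mul_smul, ih, hf, ← mul_smul, mul_comm]

/-- A `ℂ`-bilinear map that is balanced for the action of `X` factors through the tensor product
over `ℂ[X]`. -/
def liftBalanced (f : M →ₗ[ℂ] N →ₗ[ℂ] P)
    (hf : ∀ a b, f ((X : ℂ[X]) • a) b = f a ((X : ℂ[X]) • b)) : M ⊗[ℂ[X]] N →ₗ[ℂ] P where
  __ := TensorProduct.liftAddHom (LinearMap.toAddMonoidHom'.comp f.toAddMonoidHom)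
    (balanced_of_X f hf)
  map_smul' c x := by
    induction x with
    | zero => simp
    | add x y hx hy => simp_all [smul_add]
    | tmul a b =>
      rw [TensorProduct.smul_tmul']
      exact LinearMap.map_smul₂ f c a b

@[simp]
lemma liftBalanced_tmul (f : M →ₗ[ℂ] N →ₗ[ℂ] P)
    (hf : ∀ a b, f ((X : ℂ[X]) • a) b = f a ((X : ℂ[X]) • b)) (a : M) (b : N) :
    liftBalanced f hf (a ⊗ₜ b) = f a b := rfl

lemma tensor_hom_ext {M N P : Type*} [AddCommGroup M] [Module ℂ M] [Module ℂ[X] M]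
    [IsScalarTower ℂ ℂ[X] M] [AddCommGroup N] [Module ℂ[X] N] [AddCommGroup P] [Module ℂ P]
    {f g : M ⊗[ℂ[X]] N →ₗ[ℂ] P} (h : ∀ a b, f (a ⊗ₜ b) = g (a ⊗ₜ b)) :
    f = g := by
  ext x
  induction x with
  | zero => simp
  | add x y hx hy => simp [hx, hy]
  | tmul a b => exact h a b

variable (M N) in
/-- The canonical `ℂ`-bilinear map to the tensor product over `ℂ[X]`. -/
def tmulLin : M →ₗ[ℂ] N →ₗ[ℂ] M ⊗[ℂ[X]] N :=
  LinearMap.mk₂ ℂ (fun a b => a ⊗ₜ b) TensorProduct.add_tmul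
    (fun _ _ _ => (TensorProduct.smul_tmul' ..).symm)
    TensorProduct.tmul_add (fun _ _ _ => TensorProduct.tmul_smul ..)

@[simp]
lemma tmulLin_apply (a : M) (b : N) : tmulLin M N a b = a ⊗ₜ b := rfl

/-- The tensor product of two `ℂ`-linear maps commuting with `X`. -/
def mapTensor (f : M →ₗ[ℂ] M) (g : N →ₗ[ℂ] N)
    (hf : ∀ a, f ((X : ℂ[X]) • a) = (X : ℂ[X]) • f a)
    (hg : ∀ b, g ((X : ℂ[X]) • b) = (X : ℂ[X]) • g b) :
    M ⊗[ℂ[X]] N →ₗ[ℂ] M ⊗[ℂ[X]] N :=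
  liftBalanced ((tmulLin M N).compl₁₂ f g) fun a b => by
    simp [hf, hg, TensorProduct.smul_tmul]

@[simp]
lemma mapTensor_tmul (f : M →ₗ[ℂ] M) (g : N →ₗ[ℂ] N)
    (hf : ∀ a, f ((X : ℂ[X]) • a) = (X : ℂ[X]) • f a)
    (hg : ∀ b, g ((X : ℂ[X]) • b) = (X : ℂ[X]) • g b) (a : M) (b : N) :
    mapTensor f g hf hg (a ⊗ₜ b) = f a ⊗ₜ g b := rfl

end PolynomialLinearity

section PowerSums

variable {M N : Type*} [AddCommGroup M] [Module ℂ[X] M] [AddCommGroup N] [Module ℂ[X] N]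

lemma finsum_pow_smul_eq_sum (r : ℂ[X]) {u : ℕ → M} {K : ℕ} (hu : ∀ n, K ≤ n → u n = 0) :
    ∑ᶠ n, r ^ n • u n = ∑ n ∈ Finset.range K, r ^ n • u n := by
  refine finsum_eq_sum_of_support_subset _ fun n hn => ?_
  simp only [Finset.coe_range, Set.mem_Iio]
  by_contra! h
  exact hn (by simp [hu n h])

lemma antidiagonal_tmul_eq_zero {u : ℕ → M} {v : ℕ → N} {K K' : ℕ}
    (hu : ∀ n, K ≤ n → u n = 0) (hv : ∀ n, K' ≤ n → v n = 0) (n : ℕ) (hn : K + K' ≤ n) :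
    ∑ p ∈ Finset.HasAntidiagonal.antidiagonal n, u p.1 ⊗ₜ[ℂ[X]] v p.2 = 0 := by
  refine Finset.sum_eq_zero fun p hp => ?_
  rw [Finset.HasAntidiagonal.mem_antidiagonal] at hp
  rcases le_or_gt K p.1 with h | h
  · simp [hu _ h]
  · simp [hv p.2 (by omega)]

lemma finsum_pow_smul_antidiagonal_tmul (r : ℂ[X]) {u : ℕ → M} {v : ℕ → N} {K K' : ℕ}
    (hu : ∀ n, K ≤ n → u n = 0) (hv : ∀ n, K' ≤ n → v n = 0) :
    ∑ᶠ n, r ^ n • ∑ p ∈ Finset.HasAntidiagonal.antidiagonal n, u p.1 ⊗ₜ[ℂ[X]] v p.2 =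
      (∑ᶠ n, r ^ n • u n) ⊗ₜ[ℂ[X]] (∑ᶠ n, r ^ n • v n) := by
  rw [finsum_pow_smul_eq_sum r (antidiagonal_tmul_eq_zero hu hv), finsum_pow_smul_eq_sum r hu,
    finsum_pow_smul_eq_sum r hv, TensorProduct.sum_tmul]
  simp_rw [TensorProduct.tmul_sum]
  rw [← Finset.sum_product', ← Finset.sum_fiberwise_of_maps_to (t := Finset.range (K + K'))
    (g := fun p : ℕ × ℕ => p.1 + p.2)]
  · refine Finset.sum_congr rfl fun n _ => ?_
    rw [Finset.smul_sum]
    symm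
    refine Finset.sum_subset_zero_on_sdiff (fun p hp => ?_) (fun p hp => ?_) (fun p hp => ?_)
    · simp_all
    · simp only [Finset.mem_sdiff, Finset.HasAntidiagonal.mem_antidiagonal, Finset.mem_filter,
        Finset.mem_product, Finset.mem_range] at hp
      rcases le_or_gt K p.1 with h | h
      · simp [hu _ h]
      · simp [hv p.2 (by omega)]
    · simp only [Finset.mem_filter] at hp
      rw [← hp.2, pow_add, mul_smul, TensorProduct.smul_tmul', TensorProduct.tmul_smul,
        TensorProduct.smul_tmul', TensorProduct.smul_tmul', ← mul_smul, ← mul_smul, mul_comm]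
  · intro p hp
    simp only [Finset.mem_product, Finset.mem_range] at hp ⊢
    omega

lemma eq_of_finsum_pow_smul_eq {V : Type*} [AddCommGroup V] [Module ℂ V] {u v : ℕ → V} {K K' : ℕ}
    (hu : ∀ n, K ≤ n → u n = 0) (hv : ∀ n, K' ≤ n → v n = 0)
    (h : ∀ lam : ℂ, ∑ᶠ n, lam ^ n • u n = ∑ᶠ n, lam ^ n • v n) (n : ℕ) : u n = v n := by
  have key : ∀ (w : ℕ → V) (J : ℕ), (∀ n, J ≤ n → w n = 0) → J ≤ K + K' → ∀ lam : ℂ,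
      ∑ᶠ n, lam ^ n • w n = ∑ n ∈ Finset.range (K + K'), lam ^ n • w n := by
    intro w J hw hJ lam
    refine finsum_eq_sum_of_support_subset _ fun n hn => ?_
    simp only [Finset.coe_range, Set.mem_Iio]
    by_contra! h
    exact hn (by simp [hw n (by omega)])
  rcases le_or_gt (K + K') n with hn | hn
  · rw [hu n (by omega), hv n (by omega)]
  rw [← sub_eq_zero, ← Module.forall_dual_apply_eq_zero_iff ℂ]
  intro φ
  have hp : (∑ k ∈ Finset.range (K + K'), monomial k (φ (u k - v k)) : ℂ[X]) = 0 := by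
    refine Polynomial.funext fun lam => ?_
    have := congrArg φ (h lam)
    rw [key u K hu (by omega), key v K' hv (by omega), ← sub_eq_zero, ← map_sub,
      ← Finset.sum_sub_distrib] at this
    simp_rw [← smul_sub, map_sum, map_smul, smul_eq_mul] at this
    simp only [eval_finsetSum, eval_monomial, eval_zero]
    rw [← this]
    exact Finset.sum_congr rfl fun _ _ => mul_comm _ _
  have := congrArg (fun p => p.coeff n) hp
  simpa [Polynomial.finsetSum_coeff, Polynomial.coeff_monomial, hn] using this

end PowerSums

section Sign

lemma parity_eq_zero_or_one (k : ZMod 2) : k = 0 ∨ k = 1 := by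
  revert k
  decide

lemma sgn_comm (i j : ZMod 2) : sgn i j = sgn j i := by rw [sgn, sgn, mul_comm]

lemma sgn_add_left (i j k : ZMod 2) : sgn (i + j) k = sgn i k * sgn j k := by
  have h : (1 + 1 : ZMod 2) = 0 := by decide
  rcases parity_eq_zero_or_one i with rfl | rfl <;>
    rcases parity_eq_zero_or_one j with rfl | rfl <;>
    rcases parity_eq_zero_or_one k with rfl | rfl <;> simp [sgn, h, ZMod.val_one]

lemma sgn_add_right (i j k : ZMod 2) : sgn i (j + k) = sgn i j * sgn i k := by
  rw [sgn_comm, sgn_add_left, sgn_comm j, sgn_comm k]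

lemma sgn_mul_self (i j : ZMod 2) : sgn i j * sgn i j = 1 := by
  rw [sgn, ← mul_pow]; simp

end Sign

namespace ConformalProduct

variable (m : ConformalProduct L)

lemma coeff_smul_hasFiniteSupport (r : ℂ[X]) (a b : L) :
    (fun n => r ^ n • m.coeff n a b).HasFiniteSupport := by
  obtain ⟨K, hK⟩ := m.coeff_finite a b
  refine (Set.finite_Iio K).subset fun n hn => ?_
  by_contra h
  exact hn (by simp [hK n (by simpa using h)])

/-- The value of the `λ`-product at `λ = r ∈ ℂ[∂]`, with `r` acting on the result. -/
def evalAt (r : ℂ[X]) : L →ₗ[ℂ] L →ₗ[ℂ] L :=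
  LinearMap.mk₂ ℂ (fun a b => ∑ᶠ n, r ^ n • m.coeff n a b)
    (fun a a' b => by
      simp only [map_add, LinearMap.add_apply, smul_add]
      exact finsum_add_distrib (m.coeff_smul_hasFiniteSupport r a b)
        (m.coeff_smul_hasFiniteSupport r a' b))
    (fun c a b => by
      rw [smul_finsum' c (m.coeff_smul_hasFiniteSupport r a b)]
      simp only [map_smul, LinearMap.smul_apply, smul_comm (_ ^ _) c])
    (fun a b b' => by
      simp only [map_add, smul_add]
      exact finsum_add_distrib (m.coeff_smul_hasFiniteSupport r a b)
        (m.coeff_smul_hasFiniteSupport r a b'))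
    (fun c a b => by
      rw [smul_finsum' c (m.coeff_smul_hasFiniteSupport r a b)]
      simp only [map_smul, smul_comm (_ ^ _) c])

lemma evalAt_apply (r : ℂ[X]) (a b : L) :
    m.evalAt r a b = ∑ᶠ n, r ^ n • m.coeff n a b := rfl

lemma mul_eq_evalAt (lam : ℂ) (a b : L) : m.mul lam a b = m.evalAt (C lam) a b := by
  simp only [mul, evalAt_apply, ← C_pow, C_smul_eq_smul]

lemma cmul_eq_evalAt (lam : ℂ) (a b : L) :
    m.cmul lam a b = m.evalAt (-((X : ℂ[X]) + C lam)) a b := rfl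

lemma mul_mem (S : SuperModule L) {k : ZMod 2} {a b : L}
    (h : ∀ n, m.coeff n a b ∈ S.grade k) (lam : ℂ) : m.mul lam a b ∈ S.grade k := by
  rw [mul]
  exact finsum_induction (· ∈ S.grade k) (zero_mem _) (fun _ _ => add_mem)
    fun n => Submodule.smul_mem _ _ (h n)

/-- The sum of two `λ`-products. -/
def add (m p : ConformalProduct L) : ConformalProduct L where
  coeff n := m.coeff n + p.coeff n
  coeff_finite a b := by
    obtain ⟨K, hK⟩ := m.coeff_finite a b
    obtain ⟨K', hK'⟩ := p.coeff_finite a b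
    exact ⟨max K K', fun n hn => by simp [hK n (by omega), hK' n (by omega)]⟩

lemma add_evalAt (p : ConformalProduct L) (r : ℂ[X]) :
    (m.add p).evalAt r = m.evalAt r + p.evalAt r := by
  ext a b
  simp only [evalAt_apply, add, LinearMap.add_apply, smul_add]
  exact finsum_add_distrib (m.coeff_smul_hasFiniteSupport r a b)
    (p.coeff_smul_hasFiniteSupport r a b)

lemma add_mul (p : ConformalProduct L) (lam : ℂ) (a b : L) :
    (m.add p).mul lam a b = m.mul lam a b + p.mul lam a b := by
  simp [mul_eq_evalAt, add_evalAt]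

lemma mul_add_left (lam : ℂ) (a b c : L) :
    m.mul lam (a + b) c = m.mul lam a c + m.mul lam b c := by
  simp [mul_eq_evalAt]

lemma mul_add_right (lam : ℂ) (a b c : L) :
    m.mul lam a (b + c) = m.mul lam a b + m.mul lam a c := by
  simp [mul_eq_evalAt]

lemma mul_smul_left (lam s : ℂ) (a b : L) : m.mul lam (s • a) b = s • m.mul lam a b := by
  simp [mul_eq_evalAt]

lemma mul_smul_right (lam s : ℂ) (a b : L) : m.mul lam a (s • b) = s • m.mul lam a b := by
  simp [mul_eq_evalAt]

end ConformalProduct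

namespace IsLambdaProduct

variable {S : SuperModule L} {m q : ConformalProduct L}

lemma mul_mem (h : IsLambdaProduct S m) {i j : ZMod 2} {a b : L} (ha : a ∈ S.grade i)
    (hb : b ∈ S.grade j) (lam : ℂ) : m.mul lam a b ∈ S.grade (i + j) :=
  m.mul_mem S (h.even i j a b ha hb) lam

lemma add (h : IsLambdaProduct S m) (h' : IsLambdaProduct S q) :
    IsLambdaProduct S (m.add q) where
  even i j a b ha hb n := add_mem (h.even i j a b ha hb n) (h'.even i j a b ha hb n)
  sesq_left lam a b := by
    simp only [ConformalProduct.add_mul, h.sesq_left, h'.sesq_left, smul_add]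
  sesq_right lam a b := by
    simp only [ConformalProduct.add_mul, h.sesq_right, h'.sesq_right, smul_add]
    abel

lemma mul_polynomial_smul_left (h : IsLambdaProduct S m) (r : ℂ[X]) (lam : ℂ) (a b : L) :
    m.mul lam (r • a) b = r.eval (-lam) • m.mul lam a b := by
  induction r using Polynomial.induction_on generalizing a with
  | C c => simp [C_smul_eq_smul, ConformalProduct.mul_smul_left]
  | add p q hp hq => simp [add_smul, ConformalProduct.mul_add_left, hp, hq]
  | monomial n c ih =>
    rw [pow_succ, ← mul_assoc, mul_smul, ih, h.sesq_left, smul_smul]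
    simp

lemma mul_cmul_left (h : IsLambdaProduct S q) (lam mu : ℂ) (a b c : L) :
    q.mul (lam + mu) (m.cmul lam b a) c = q.mul (lam + mu) (m.mul mu b a) c := by
  have hfin (r : ℂ[X]) : q.mul (lam + mu) (m.evalAt r b a) c =
      ∑ᶠ n, r.eval (-(lam + mu)) ^ n • q.mul (lam + mu) (m.coeff n b a) c := by
    have key (x : L) : q.mul (lam + mu) x c =
        ((q.evalAt (C (lam + mu))).flip c).toAddMonoidHom x := q.mul_eq_evalAt _ _ _
    rw [key, ConformalProduct.evalAt_apply,
      AddMonoidHom.map_finsum _ (m.coeff_smul_hasFiniteSupport r b a)]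
    refine finsum_congr fun n => ?_
    rw [← key, h.mul_polynomial_smul_left, eval_pow]
  rw [ConformalProduct.cmul_eq_evalAt, ConformalProduct.mul_eq_evalAt m, hfin, hfin]
  simp

end IsLambdaProduct

namespace IsCommAssoc

variable {S : SuperModule L} {m q : ConformalProduct L}

lemma mul_mul_swap (h : IsCommAssoc S m) (hq : IsLambdaProduct S q) {i j : ZMod 2} {a b : L}
    (ha : a ∈ S.grade i) (hb : b ∈ S.grade j) (lam mu : ℂ) (c : L) :
    q.mul (lam + mu) (m.mul lam a b) c = sgn i j • q.mul (lam + mu) (m.mul mu b a) c := by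
  rw [h.comm i j a b ha hb, ConformalProduct.mul_smul_left, hq.mul_cmul_left]

lemma mul_left_comm (h : IsCommAssoc S m) {i j : ZMod 2} {a b : L} (ha : a ∈ S.grade i)
    (hb : b ∈ S.grade j) (lam mu : ℂ) (c : L) :
    m.mul lam a (m.mul mu b c) = sgn i j • m.mul mu b (m.mul lam a c) := by
  rw [h.assoc, h.assoc, h.mul_mul_swap h.toIsLambdaProduct ha hb, add_comm mu]

end IsCommAssoc

namespace SuperModule

variable (S : SuperModule L)

/-- The projection of a `ℤ₂`-graded module onto its homogeneous component of parity `i`. -/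
def proj (i : ZMod 2) : L →ₗ[ℂ] L :=
  letI := S.isInternal.chooseDecomposition
  (S.grade i).subtype ∘ₗ DirectSum.component ℂ (ZMod 2) (fun j => S.grade j) i ∘ₗ
    (DirectSum.decomposeLinearEquiv S.grade).toLinearMap

lemma proj_of_mem {i j : ZMod 2} {a : L} (ha : a ∈ S.grade j) :
    S.proj i a = if i = j then a else 0 := by
  let _ := S.isInternal.chooseDecomposition
  change (DirectSum.decompose S.grade a i : L) = _
  split_ifs with h
  · subst h
    exact DirectSum.decompose_of_mem_same _ ha
  · exact DirectSum.decompose_of_mem_ne _ ha (Ne.symm h)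

lemma proj_mem (i : ZMod 2) (a : L) : S.proj i a ∈ S.grade i := by
  let _ := S.isInternal.chooseDecomposition
  exact (DirectSum.decompose S.grade a i).2

lemma sum_proj (a : L) : ∑ i, S.proj i a = a := by
  classical
  let _ := S.isInternal.chooseDecomposition
  conv_rhs => rw [← DirectSum.sum_support_decompose S.grade a]
  refine (Finset.sum_subset (Finset.subset_univ _) fun i _ hi => ?_).symm
  have h : DirectSum.decompose S.grade a i = 0 := by simpa using hi
  exact congrArg Subtype.val h

lemma proj_X_smul (i : ZMod 2) (a : L) :
    S.proj i ((X : ℂ[X]) • a) = (X : ℂ[X]) • S.proj i a := by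
  conv_lhs => rw [← S.sum_proj a]
  simp only [Finset.smul_sum, map_sum]
  simp [S.proj_of_mem (S.X_smul_mem _ _ (S.proj_mem _ a))]

/-- The map acting on the homogeneous component of parity `j` as `sgn i j`. -/
def signMap (i : ZMod 2) : L →ₗ[ℂ] L := ∑ j, sgn i j • S.proj j

lemma signMap_of_mem {i j : ZMod 2} {a : L} (ha : a ∈ S.grade j) :
    S.signMap i a = sgn i j • a := by
  simp [signMap, S.proj_of_mem ha]

lemma signMap_X_smul (i : ZMod 2) (a : L) :
    S.signMap i ((X : ℂ[X]) • a) = (X : ℂ[X]) • S.signMap i a := by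
  simp only [signMap, LinearMap.sum_apply, LinearMap.smul_apply, proj_X_smul, Finset.smul_sum,
    smul_comm (X : ℂ[X])]

end SuperModule

section TensorGrading

variable {M N P : Type*} [AddCommGroup M] [Module ℂ M] [Module ℂ[X] M] [IsScalarTower ℂ ℂ[X] M]
  [AddCommGroup N] [Module ℂ N] [Module ℂ[X] N] [IsScalarTower ℂ ℂ[X] N]
  [AddCommGroup P] [Module ℂ P] (S : SuperModule M) (T : SuperModule N)

/-- The span of the tensors of homogeneous elements with total parity `k`. -/
def tensorGrade (k : ZMod 2) : Submodule ℂ (M ⊗[ℂ[X]] N) :=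
  Submodule.span ℂ {t | ∃ (i j : ZMod 2) (a : M) (b : N),
    i + j = k ∧ a ∈ S.grade i ∧ b ∈ T.grade j ∧ t = a ⊗ₜ[ℂ[X]] b}

variable {S T} in
lemma tmul_mem_tensorGrade {i j : ZMod 2} {a : M} {b : N} (ha : a ∈ S.grade i)
    (hb : b ∈ T.grade j) : a ⊗ₜ[ℂ[X]] b ∈ tensorGrade S T (i + j) :=
  Submodule.subset_span ⟨i, j, a, b, rfl, ha, hb, rfl⟩

variable {S T} in
lemma eqOn_tensorGrade {k : ZMod 2} {f g : M ⊗[ℂ[X]] N →ₗ[ℂ] P}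
    (h : ∀ (i j : ZMod 2) (a : M) (b : N), i + j = k → a ∈ S.grade i → b ∈ T.grade j →
      f (a ⊗ₜ b) = g (a ⊗ₜ b)) {x : M ⊗[ℂ[X]] N} (hx : x ∈ tensorGrade S T k) : f x = g x := by
  refine LinearMap.eqOn_span (f := f) (g := g) ?_ hx
  rintro _ ⟨i, j, a, b, hk, ha, hb, rfl⟩
  exact h i j a b hk ha hb

lemma homogeneous_tensor_hom_ext {f g : M ⊗[ℂ[X]] N →ₗ[ℂ] P}
    (h : ∀ (i j : ZMod 2) (a : M) (b : N), a ∈ S.grade i → b ∈ T.grade j →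
      f (a ⊗ₜ b) = g (a ⊗ₜ b)) : f = g := by
  refine tensor_hom_ext fun a b => ?_
  rw [← S.sum_proj a, ← T.sum_proj b, TensorProduct.sum_tmul]
  simp only [TensorProduct.tmul_sum, map_sum]
  exact Finset.sum_congr rfl fun i _ => Finset.sum_congr rfl fun j _ =>
    h i j _ _ (S.proj_mem i a) (T.proj_mem j b)

variable {S T} in
lemma eqOn_tensorGrade_bilinear {k l : ZMod 2} {F G : M ⊗[ℂ[X]] N →ₗ[ℂ] M ⊗[ℂ[X]] N →ₗ[ℂ] P}
    (h : ∀ (i₁ i₂ j₁ j₂ : ZMod 2) (a₁ b₁ : M) (a₂ b₂ : N), i₁ + i₂ = k → j₁ + j₂ = l →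
      a₁ ∈ S.grade i₁ → a₂ ∈ T.grade i₂ → b₁ ∈ S.grade j₁ → b₂ ∈ T.grade j₂ →
      F (a₁ ⊗ₜ a₂) (b₁ ⊗ₜ b₂) = G (a₁ ⊗ₜ a₂) (b₁ ⊗ₜ b₂))
    {x y : M ⊗[ℂ[X]] N} (hx : x ∈ tensorGrade S T k) (hy : y ∈ tensorGrade S T l) :
    F x y = G x y := by
  refine eqOn_tensorGrade (f := F.flip y) (g := G.flip y) (fun i₁ i₂ a₁ a₂ hk ha₁ ha₂ => ?_) hx
  exact eqOn_tensorGrade (f := F (a₁ ⊗ₜ a₂)) (g := G (a₁ ⊗ₜ a₂))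
    (fun j₁ j₂ b₁ b₂ hl hb₁ hb₂ => h i₁ i₂ j₁ j₂ a₁ b₁ a₂ b₂ hk hl ha₁ ha₂ hb₁ hb₂) hy

lemma homogeneous_tensor_bilinear_ext {F G : M ⊗[ℂ[X]] N →ₗ[ℂ] M ⊗[ℂ[X]] N →ₗ[ℂ] P}
    (h : ∀ (i₁ i₂ j₁ j₂ : ZMod 2) (a₁ b₁ : M) (a₂ b₂ : N),
      a₁ ∈ S.grade i₁ → a₂ ∈ T.grade i₂ → b₁ ∈ S.grade j₁ → b₂ ∈ T.grade j₂ →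
      F (a₁ ⊗ₜ a₂) (b₁ ⊗ₜ b₂) = G (a₁ ⊗ₜ a₂) (b₁ ⊗ₜ b₂)) : F = G :=
  homogeneous_tensor_hom_ext S T fun i₁ i₂ a₁ a₂ ha₁ ha₂ =>
    homogeneous_tensor_hom_ext S T fun j₁ j₂ b₁ b₂ hb₁ hb₂ =>
      h i₁ i₂ j₁ j₂ a₁ b₁ a₂ b₂ ha₁ ha₂ hb₁ hb₂

/-- The trilinear map `(x, y, z) ↦ A x (B y z)`. -/
def nestRight {V : Type*} [AddCommGroup V] [Module ℂ V] (A B : V →ₗ[ℂ] V →ₗ[ℂ] V) :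
    V →ₗ[ℂ] V →ₗ[ℂ] V →ₗ[ℂ] V :=
  LinearMap.mk₂ ℂ (fun x y => A x ∘ₗ B y) (by intros; ext; simp) (by intros; ext; simp)
    (by intros; ext; simp) (by intros; ext; simp)

lemma nestRight_apply {V : Type*} [AddCommGroup V] [Module ℂ V] (A B : V →ₗ[ℂ] V →ₗ[ℂ] V)
    (x y z : V) : nestRight A B x y z = A x (B y z) := rfl

/-- The `ℤ₂`-grading on the tensor product over `ℂ[∂]`. -/
def tensorSuperModule : SuperModule (M ⊗[ℂ[X]] N) where
  grade := tensorGrade S T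
  isInternal := by
    rw [DirectSum.isInternal_submodule_iff_isCompl (tensorGrade S T) (i := 0) (j := 1)
      zero_ne_one (by ext i; simpa using parity_eq_zero_or_one i)]
    let σ : M ⊗[ℂ[X]] N →ₗ[ℂ] M ⊗[ℂ[X]] N :=
      mapTensor (S.signMap 1) (T.signMap 1) (S.signMap_X_smul 1) (T.signMap_X_smul 1)
    have hσ (k : ZMod 2) (x : M ⊗[ℂ[X]] N) (hx : x ∈ tensorGrade S T k) : σ x = sgn 1 k • x := by
      refine eqOn_tensorGrade (f := σ) (g := sgn 1 k • LinearMap.id) ?_ hx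
      rintro i j a b rfl ha hb
      simp only [σ, mapTensor_tmul, S.signMap_of_mem ha, T.signMap_of_mem hb, sgn_add_right,
        TensorProduct.tmul_smul, ← TensorProduct.smul_tmul', smul_smul, LinearMap.smul_apply,
        LinearMap.id_apply, mul_comm]
    refine ⟨Submodule.disjoint_def.2 fun x h0 h1 => ?_, codisjoint_iff.2 <| top_le_iff.1 ?_⟩
    · have := (hσ 0 x h0).symm.trans (hσ 1 x h1)
      simp only [sgn, ZMod.val_zero, ZMod.val_one, mul_zero, mul_one, pow_zero, pow_one,
        one_smul, neg_smul] at this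
      refine (smul_eq_zero.1 (?_ : (2 : ℂ) • x = 0)).resolve_left two_ne_zero
      rw [two_smul]
      exact add_eq_zero_iff_eq_neg.2 this
    · have key : (tensorGrade S T 0 ⊔ tensorGrade S T 1).mkQ = 0 := by
        refine homogeneous_tensor_hom_ext S T fun i j a b ha hb => ?_
        rw [Submodule.mkQ_apply, LinearMap.zero_apply, Submodule.Quotient.mk_eq_zero]
        have h := tmul_mem_tensorGrade ha hb
        rcases parity_eq_zero_or_one (i + j) with hk | hk <;> rw [hk] at h
        · exact Submodule.mem_sup_left h
        · exact Submodule.mem_sup_right h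
      intro x _
      rw [← Submodule.Quotient.mk_eq_zero, ← Submodule.mkQ_apply, key, LinearMap.zero_apply]
  X_smul_mem k x hx := by
    induction hx using Submodule.span_induction with
    | zero => simp
    | add x y _ _ hx hy => simpa using add_mem hx hy
    | smul c x _ hx => rw [smul_comm]; exact Submodule.smul_mem _ _ hx
    | mem x h =>
      obtain ⟨i, j, a, b, rfl, ha, hb, rfl⟩ := h
      rw [TensorProduct.smul_tmul']
      exact tmul_mem_tensorGrade (S.X_smul_mem i a ha) hb

end TensorGrading

section TensorProductOfProducts

variable {M N : Type*} [AddCommGroup M] [Module ℂ M] [Module ℂ[X] M] [IsScalarTower ℂ ℂ[X] M]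
  [AddCommGroup N] [Module ℂ N] [Module ℂ[X] N] [IsScalarTower ℂ ℂ[X] N]
  {S : SuperModule M} {T : SuperModule N} {q₁ : ConformalProduct M} {q₂ : ConformalProduct N}

variable (q₁ q₂) in
/-- The `n`-th coefficient of `(a₁ ∘_λ b₁) ⊗ (a₂ ∘_λ b₂)`, as a bilinear map in `b₁` and `b₂`. -/
def tmulCoeff (n : ℕ) (a₁ : M) (a₂ : N) : M →ₗ[ℂ] N →ₗ[ℂ] M ⊗[ℂ[X]] N :=
  ∑ p ∈ Finset.HasAntidiagonal.antidiagonal n,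
    (tmulLin M N).compl₁₂ (q₁.coeff p.1 a₁) (q₂.coeff p.2 a₂)

lemma tmulCoeff_apply (n : ℕ) (a₁ b₁ : M) (a₂ b₂ : N) :
    tmulCoeff q₁ q₂ n a₁ a₂ b₁ b₂ = ∑ p ∈ Finset.HasAntidiagonal.antidiagonal n,
      q₁.coeff p.1 a₁ b₁ ⊗ₜ[ℂ[X]] q₂.coeff p.2 a₂ b₂ := by
  simp [tmulCoeff]

lemma tmulCoeff_finite (a₁ b₁ : M) (a₂ b₂ : N) :
    ∃ K : ℕ, ∀ n, K ≤ n → tmulCoeff q₁ q₂ n a₁ a₂ b₁ b₂ = 0 := by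
  obtain ⟨K, hK⟩ := q₁.coeff_finite a₁ b₁
  obtain ⟨K', hK'⟩ := q₂.coeff_finite a₂ b₂
  exact ⟨K + K', fun n hn => by rw [tmulCoeff_apply, antidiagonal_tmul_eq_zero hK hK' n hn]⟩

lemma finsum_tmulCoeff (r : ℂ[X]) (a₁ b₁ : M) (a₂ b₂ : N) :
    ∑ᶠ n, r ^ n • tmulCoeff q₁ q₂ n a₁ a₂ b₁ b₂ =
      q₁.evalAt r a₁ b₁ ⊗ₜ[ℂ[X]] q₂.evalAt r a₂ b₂ := by
  obtain ⟨K, hK⟩ := q₁.coeff_finite a₁ b₁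
  obtain ⟨K', hK'⟩ := q₂.coeff_finite a₂ b₂
  simp only [tmulCoeff_apply]
  exact finsum_pow_smul_antidiagonal_tmul r hK hK'

lemma tmulCoeff_eq_of_mul_eq {a₁ b₁ a₁' b₁' : M} {a₂ b₂ a₂' b₂' : N}
    (h : ∀ lam, q₁.mul lam a₁ b₁ ⊗ₜ[ℂ[X]] q₂.mul lam a₂ b₂ =
      q₁.mul lam a₁' b₁' ⊗ₜ[ℂ[X]] q₂.mul lam a₂' b₂') (n : ℕ) :
    tmulCoeff q₁ q₂ n a₁ a₂ b₁ b₂ = tmulCoeff q₁ q₂ n a₁' a₂' b₁' b₂' := by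
  obtain ⟨K, hK⟩ := tmulCoeff_finite (q₁ := q₁) (q₂ := q₂) a₁ b₁ a₂ b₂
  obtain ⟨K', hK'⟩ := tmulCoeff_finite (q₁ := q₁) (q₂ := q₂) a₁' b₁' a₂' b₂'
  refine eq_of_finsum_pow_smul_eq hK hK' (fun lam => ?_) n
  have := h lam
  simp only [ConformalProduct.mul_eq_evalAt, ← finsum_tmulCoeff, ← C_pow, C_smul_eq_smul] at this
  exact this

/-- The tensor product of two `λ`-products without signs, coefficientwise. -/
def unsignedCoeff (h₁ : IsLambdaProduct S q₁) (h₂ : IsLambdaProduct T q₂) (n : ℕ) :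
    M ⊗[ℂ[X]] N →ₗ[ℂ] M ⊗[ℂ[X]] N →ₗ[ℂ] M ⊗[ℂ[X]] N :=
  liftBalanced
    (LinearMap.mk₂ ℂ
      (fun a₁ a₂ => liftBalanced (tmulCoeff q₁ q₂ n a₁ a₂) fun b₁ b₂ =>
        tmulCoeff_eq_of_mul_eq (fun lam => by
          rw [h₁.sesq_right, h₂.sesq_right, TensorProduct.add_tmul, TensorProduct.tmul_add,
            TensorProduct.smul_tmul, TensorProduct.smul_tmul lam]) n)
      (fun _ _ _ => tensor_hom_ext fun _ _ => by
        simp [tmulCoeff_apply, TensorProduct.add_tmul, Finset.sum_add_distrib])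
      (fun _ _ _ => tensor_hom_ext fun _ _ => by
        simp [tmulCoeff_apply, TensorProduct.smul_tmul', Finset.smul_sum])
      (fun _ _ _ => tensor_hom_ext fun _ _ => by
        simp [tmulCoeff_apply, TensorProduct.tmul_add, Finset.sum_add_distrib])
      (fun _ _ _ => tensor_hom_ext fun _ _ => by
        simp [tmulCoeff_apply, TensorProduct.tmul_smul, Finset.smul_sum]))
    fun a₁ a₂ => tensor_hom_ext fun b₁ b₂ =>
      tmulCoeff_eq_of_mul_eq (fun lam => by
        rw [h₁.sesq_left, h₂.sesq_left, TensorProduct.smul_tmul]) n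

lemma unsignedCoeff_tmul (h₁ : IsLambdaProduct S q₁) (h₂ : IsLambdaProduct T q₂) (n : ℕ)
    (a₁ b₁ : M) (a₂ b₂ : N) :
    unsignedCoeff h₁ h₂ n (a₁ ⊗ₜ a₂) (b₁ ⊗ₜ b₂) = tmulCoeff q₁ q₂ n a₁ a₂ b₁ b₂ := rfl

lemma unsignedCoeff_finite (h₁ : IsLambdaProduct S q₁) (h₂ : IsLambdaProduct T q₂)
    (x y : M ⊗[ℂ[X]] N) : ∃ K : ℕ, ∀ n, K ≤ n → unsignedCoeff h₁ h₂ n x y = 0 := by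
  induction x with
  | zero => exact ⟨0, by simp⟩
  | add x x' hx hx' =>
    obtain ⟨K, hK⟩ := hx
    obtain ⟨K', hK'⟩ := hx'
    exact ⟨max K K', fun n hn => by simp [hK n (by omega), hK' n (by omega)]⟩
  | tmul a₁ a₂ =>
    induction y with
    | zero => exact ⟨0, by simp⟩
    | add y y' hy hy' =>
      obtain ⟨K, hK⟩ := hy
      obtain ⟨K', hK'⟩ := hy'
      exact ⟨max K K', fun n hn => by simp [hK n (by omega), hK' n (by omega)]⟩
    | tmul b₁ b₂ => exact tmulCoeff_finite a₁ b₁ a₂ b₂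

/-- The tensor product of two `λ`-products, with the super-sign `(-1)^{|a₂||b₁|}`. -/
def tensorLambda (h₁ : IsLambdaProduct S q₁) (h₂ : IsLambdaProduct T q₂) :
    ConformalProduct (M ⊗[ℂ[X]] N) where
  coeff n := ∑ i, (unsignedCoeff h₁ h₂ n).compl₁₂
    (mapTensor LinearMap.id (T.proj i) (fun _ => rfl) (T.proj_X_smul i))
    (mapTensor (S.signMap i) LinearMap.id (S.signMap_X_smul i) fun _ => rfl)
  coeff_finite x y := by
    choose K hK using fun i => unsignedCoeff_finite h₁ h₂
      (mapTensor LinearMap.id (T.proj i) (fun _ => rfl) (T.proj_X_smul i) x)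
      (mapTensor (S.signMap i) LinearMap.id (S.signMap_X_smul i) (fun _ => rfl) y)
    refine ⟨∑ i, K i, fun n hn => ?_⟩
    simp only [LinearMap.sum_apply, LinearMap.compl₁₂_apply]
    refine Finset.sum_eq_zero fun i hi => hK i n ?_
    exact (Finset.single_le_sum (fun _ _ => Nat.zero_le _) hi).trans hn

variable (h₁ : IsLambdaProduct S q₁) (h₂ : IsLambdaProduct T q₂)

lemma tensorLambda_coeff_tmul (n : ℕ) {i₂ j₁ : ZMod 2} (a₁ : M) {b₁ : M} {a₂ : N} (b₂ : N)
    (ha₂ : a₂ ∈ T.grade i₂) (hb₁ : b₁ ∈ S.grade j₁) :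
    (tensorLambda h₁ h₂).coeff n (a₁ ⊗ₜ a₂) (b₁ ⊗ₜ b₂) =
      sgn i₂ j₁ • tmulCoeff q₁ q₂ n a₁ a₂ b₁ b₂ := by
  simp only [tensorLambda, LinearMap.sum_apply, LinearMap.compl₁₂_apply, mapTensor_tmul,
    LinearMap.id_apply, T.proj_of_mem ha₂, S.signMap_of_mem hb₁]
  rw [Finset.sum_eq_single i₂ (fun i _ hi => by simp [hi]) (by simp)]
  rw [if_pos rfl, ← TensorProduct.smul_tmul', map_smul, unsignedCoeff_tmul]

lemma tensorLambda_evalAt_tmul (r : ℂ[X]) {i₂ j₁ : ZMod 2} (a₁ : M) {b₁ : M} {a₂ : N} (b₂ : N)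
    (ha₂ : a₂ ∈ T.grade i₂) (hb₁ : b₁ ∈ S.grade j₁) :
    (tensorLambda h₁ h₂).evalAt r (a₁ ⊗ₜ a₂) (b₁ ⊗ₜ b₂) =
      sgn i₂ j₁ • (q₁.evalAt r a₁ b₁ ⊗ₜ[ℂ[X]] q₂.evalAt r a₂ b₂) := by
  obtain ⟨K, hK⟩ := tmulCoeff_finite (q₁ := q₁) (q₂ := q₂) a₁ b₁ a₂ b₂
  rw [ConformalProduct.evalAt_apply, ← finsum_tmulCoeff, smul_finsum]
  simp only [tensorLambda_coeff_tmul h₁ h₂ _ a₁ b₂ ha₂ hb₁, smul_comm (r ^ _) (sgn i₂ j₁)]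

lemma tensorLambda_mul_tmul (lam : ℂ) {i₂ j₁ : ZMod 2} (a₁ : M) {b₁ : M} {a₂ : N} (b₂ : N)
    (ha₂ : a₂ ∈ T.grade i₂) (hb₁ : b₁ ∈ S.grade j₁) :
    (tensorLambda h₁ h₂).mul lam (a₁ ⊗ₜ a₂) (b₁ ⊗ₜ b₂) =
      sgn i₂ j₁ • (q₁.mul lam a₁ b₁ ⊗ₜ[ℂ[X]] q₂.mul lam a₂ b₂) := by
  simp only [ConformalProduct.mul_eq_evalAt, tensorLambda_evalAt_tmul h₁ h₂ _ a₁ b₂ ha₂ hb₁]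

lemma isLambdaProduct_tensorLambda :
    IsLambdaProduct (tensorSuperModule S T) (tensorLambda h₁ h₂) where
  even i j x y hx hy n := by
    refine (Submodule.Quotient.mk_eq_zero _).1 (eqOn_tensorGrade_bilinear
      (F := ((tensorLambda h₁ h₂).coeff n).compr₂ (tensorGrade S T (i + j)).mkQ) (G := 0)
      (fun i₁ i₂ j₁ j₂ a₁ b₁ a₂ b₂ hi hj ha₁ ha₂ hb₁ hb₂ => ?_) hx hy)
    refine (Submodule.Quotient.mk_eq_zero _).2 ?_
    rw [tensorLambda_coeff_tmul h₁ h₂ n a₁ b₂ ha₂ hb₁, tmulCoeff_apply, ← hi, ← hj,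
      add_add_add_comm]
    exact Submodule.smul_mem _ _ (Submodule.sum_mem _ fun p _ => tmul_mem_tensorGrade
      (h₁.even _ _ _ _ ha₁ hb₁ _) (h₂.even _ _ _ _ ha₂ hb₂ _))
  sesq_left lam x y := by
    simp only [ConformalProduct.mul_eq_evalAt]
    refine LinearMap.congr_fun₂ (homogeneous_tensor_bilinear_ext S T
      (F := ((tensorLambda h₁ h₂).evalAt (C lam)).comp (smulLin X))
      (G := -lam • (tensorLambda h₁ h₂).evalAt (C lam))
      fun i₁ i₂ j₁ j₂ a₁ b₁ a₂ b₂ ha₁ ha₂ hb₁ hb₂ => ?_) x y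
    simp only [LinearMap.comp_apply, smulLin_apply, LinearMap.smul_apply,
      TensorProduct.smul_tmul', ← ConformalProduct.mul_eq_evalAt,
      tensorLambda_mul_tmul h₁ h₂ lam _ b₂ ha₂ hb₁, h₁.sesq_left]
    simp only [← TensorProduct.smul_tmul', smul_comm (-lam) (sgn i₂ j₁)]
  sesq_right lam x y := by
    simp only [ConformalProduct.mul_eq_evalAt]
    refine LinearMap.congr_fun₂ (homogeneous_tensor_bilinear_ext S T
      (F := ((tensorLambda h₁ h₂).evalAt (C lam)).compl₂ (smulLin X))
      (G := ((tensorLambda h₁ h₂).evalAt (C lam)).compr₂ (smulLin X) +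
        lam • (tensorLambda h₁ h₂).evalAt (C lam))
      fun i₁ i₂ j₁ j₂ a₁ b₁ a₂ b₂ ha₁ ha₂ hb₁ hb₂ => ?_) x y
    simp only [LinearMap.compl₂_apply, LinearMap.compr₂_apply, smulLin_apply, LinearMap.smul_apply,
      LinearMap.add_apply, TensorProduct.smul_tmul', ← ConformalProduct.mul_eq_evalAt,
      tensorLambda_mul_tmul h₁ h₂ lam a₁ b₂ ha₂ hb₁,
      tensorLambda_mul_tmul h₁ h₂ lam a₁ b₂ ha₂ (S.X_smul_mem _ _ hb₁), h₁.sesq_right]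
    simp only [TensorProduct.add_tmul, ← TensorProduct.smul_tmul', smul_add,
      smul_comm (X : ℂ[X]) (sgn i₂ j₁), smul_comm lam (sgn i₂ j₁)]

end TensorProductOfProducts

namespace IsPreLiePoisson

variable {S : SuperModule L} {m p : ConformalProduct L}

lemma comm_mul_mul (h : IsPreLiePoisson S m p) (lam mu : ℂ) (a b c : L) :
    m.mul (lam + mu) (m.mul mu b a) c = m.mul mu b (m.mul lam a c) := by
  rw [add_comm, h.commAssoc.assoc]

lemma comm_preLie_mul (h : IsPreLiePoisson S m p) (lam mu : ℂ) (a b c : L) :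
    p.mul (lam + mu) (m.mul mu b a) c = m.mul mu b (p.mul lam a c) := by
  rw [add_comm, h.compat₁]

lemma comm_preLie_left_comm (h : IsPreLiePoisson S m p) {i j : ZMod 2} {a b : L}
    (ha : a ∈ S.grade i) (hb : b ∈ S.grade j) (lam mu : ℂ) (c : L) :
    m.mul lam a (p.mul mu b c) = sgn i j • m.mul mu b (p.mul lam a c) := by
  rw [← h.compat₁, h.commAssoc.mul_mul_swap h.leftSymmetric.toIsLambdaProduct ha hb,
    h.comm_preLie_mul]

end IsPreLiePoisson

section TensorIdentities

variable {M N : Type*} [AddCommGroup M] [Module ℂ M] [Module ℂ[X] M] [IsScalarTower ℂ ℂ[X] M]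
  [AddCommGroup N] [Module ℂ N] [Module ℂ[X] N] [IsScalarTower ℂ ℂ[X] N]
  {S : SuperModule M} {T : SuperModule N} {q₁ q₁' m₁ p₁ : ConformalProduct M}
  {q₂ q₂' m₂ p₂ : ConformalProduct N}

/-- The sign of the reordering `a₁ a₂ b₁ b₂ c₁ c₂ ↦ a₁ b₁ c₁ a₂ b₂ c₂`, depending on the
parities of `a₂`, `b₁`, `b₂` and `c₁`. -/
def tripleSgn (i₂ j₁ j₂ k₁ : ZMod 2) : ℂ := sgn i₂ j₁ * sgn i₂ k₁ * sgn j₂ k₁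

lemma sgn_mul_sgn_swap (i₁ i₂ j₁ j₂ : ZMod 2) :
    sgn (i₁ + i₂) (j₁ + j₂) * sgn j₂ i₁ = sgn i₂ j₁ * (sgn i₁ j₁ * sgn i₂ j₂) := by
  simp only [sgn_add_left, sgn_add_right, sgn_comm j₂ i₁]
  linear_combination sgn i₁ j₁ * sgn i₂ j₁ * sgn i₂ j₂ * sgn_mul_self i₁ j₂

lemma sgn_mul_tripleSgn_swap (i₁ i₂ j₁ j₂ k₁ : ZMod 2) :
    sgn (i₁ + i₂) (j₁ + j₂) * tripleSgn j₂ i₁ i₂ k₁ =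
      tripleSgn i₂ j₁ j₂ k₁ * (sgn i₁ j₁ * sgn i₂ j₂) := by
  simp only [tripleSgn]
  linear_combination sgn j₂ k₁ * sgn i₂ k₁ * sgn_mul_sgn_swap i₁ i₂ j₁ j₂

lemma tensorLambda_mul_mul_left (h₁ : IsLambdaProduct S q₁) (h₂ : IsLambdaProduct T q₂)
    (h₁' : IsLambdaProduct S q₁') (h₂' : IsLambdaProduct T q₂') (lam mu : ℂ)
    {i₂ j₁ j₂ k₁ : ZMod 2} (a₁ : M) {b₁ c₁ : M} {a₂ b₂ : N} (c₂ : N) (ha₂ : a₂ ∈ T.grade i₂)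
    (hb₁ : b₁ ∈ S.grade j₁) (hb₂ : b₂ ∈ T.grade j₂) (hc₁ : c₁ ∈ S.grade k₁) :
    (tensorLambda h₁ h₂).mul mu ((tensorLambda h₁' h₂').mul lam (a₁ ⊗ₜ a₂) (b₁ ⊗ₜ b₂))
        (c₁ ⊗ₜ c₂) =
      tripleSgn i₂ j₁ j₂ k₁ • (q₁.mul mu (q₁'.mul lam a₁ b₁) c₁ ⊗ₜ[ℂ[X]]
        q₂.mul mu (q₂'.mul lam a₂ b₂) c₂) := by
  rw [tensorLambda_mul_tmul h₁' h₂' lam a₁ b₂ ha₂ hb₁, ConformalProduct.mul_smul_left,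
    tensorLambda_mul_tmul h₁ h₂ mu _ c₂ (h₂'.mul_mem ha₂ hb₂ lam) hc₁, smul_smul,
    sgn_add_left, tripleSgn, mul_assoc]

lemma tensorLambda_mul_mul_right (h₁ : IsLambdaProduct S q₁) (h₂ : IsLambdaProduct T q₂)
    (h₁' : IsLambdaProduct S q₁') (h₂' : IsLambdaProduct T q₂') (lam mu : ℂ)
    {i₂ j₁ j₂ k₁ : ZMod 2} (a₁ : M) {b₁ c₁ : M} {a₂ b₂ : N} (c₂ : N) (ha₂ : a₂ ∈ T.grade i₂)
    (hb₁ : b₁ ∈ S.grade j₁) (hb₂ : b₂ ∈ T.grade j₂) (hc₁ : c₁ ∈ S.grade k₁) :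
    (tensorLambda h₁ h₂).mul lam (a₁ ⊗ₜ a₂) ((tensorLambda h₁' h₂').mul mu (b₁ ⊗ₜ b₂)
        (c₁ ⊗ₜ c₂)) =
      tripleSgn i₂ j₁ j₂ k₁ • (q₁.mul lam a₁ (q₁'.mul mu b₁ c₁) ⊗ₜ[ℂ[X]]
        q₂.mul lam a₂ (q₂'.mul mu b₂ c₂)) := by
  rw [tensorLambda_mul_tmul h₁' h₂' mu b₁ c₂ hb₂ hc₁, ConformalProduct.mul_smul_right,
    tensorLambda_mul_tmul h₁ h₂ lam a₁ _ ha₂ (h₁'.mul_mem hb₁ hc₁ mu), smul_smul,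
    sgn_add_right, tripleSgn, mul_comm]

lemma isCommAssoc_tensorLambda (h₁ : IsCommAssoc S m₁) (h₂ : IsCommAssoc T m₂) :
    IsCommAssoc (tensorSuperModule S T)
      (tensorLambda h₁.toIsLambdaProduct h₂.toIsLambdaProduct) where
  toIsLambdaProduct := isLambdaProduct_tensorLambda _ _
  comm i j x y hx hy lam := by
    set m := tensorLambda h₁.toIsLambdaProduct h₂.toIsLambdaProduct
    rw [ConformalProduct.cmul_eq_evalAt, ConformalProduct.mul_eq_evalAt]
    refine eqOn_tensorGrade_bilinear (F := m.evalAt (C lam))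
      (G := sgn i j • (m.evalAt (-((X : ℂ[X]) + C lam))).flip) ?_ hx hy
    rintro i₁ i₂ j₁ j₂ a₁ b₁ a₂ b₂ rfl rfl ha₁ ha₂ hb₁ hb₂
    rw [LinearMap.smul_apply, LinearMap.smul_apply, LinearMap.flip_apply,
      ← ConformalProduct.mul_eq_evalAt, tensorLambda_mul_tmul _ _ lam a₁ b₂ ha₂ hb₁,
      tensorLambda_evalAt_tmul _ _ _ b₁ a₂ hb₂ ha₁, smul_smul, sgn_mul_sgn_swap,
      h₁.comm _ _ _ _ ha₁ hb₁, h₂.comm _ _ _ _ ha₂ hb₂, ← ConformalProduct.cmul_eq_evalAt,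
      ← ConformalProduct.cmul_eq_evalAt, TensorProduct.tmul_smul, ← TensorProduct.smul_tmul']
    module
  assoc lam mu x y z := by
    set m := tensorLambda h₁.toIsLambdaProduct h₂.toIsLambdaProduct with hm
    simp only [ConformalProduct.mul_eq_evalAt]
    refine LinearMap.congr_fun (LinearMap.congr_fun₂ (homogeneous_tensor_bilinear_ext S T
      (F := nestRight (m.evalAt (C lam)) (m.evalAt (C mu)))
      (G := (m.evalAt (C lam)).compr₂ (m.evalAt (C (lam + mu))))
      fun i₁ i₂ j₁ j₂ a₁ b₁ a₂ b₂ ha₁ ha₂ hb₁ hb₂ =>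
        homogeneous_tensor_hom_ext S T fun k₁ k₂ c₁ c₂ hc₁ hc₂ => ?_) x y) z
    simp only [nestRight_apply, LinearMap.compr₂_apply, ← ConformalProduct.mul_eq_evalAt]
    rw [hm, tensorLambda_mul_mul_right _ _ _ _ lam mu a₁ c₂ ha₂ hb₁ hb₂ hc₁,
      tensorLambda_mul_mul_left _ _ _ _ lam (lam + mu) a₁ c₂ ha₂ hb₁ hb₂ hc₁, h₁.assoc, h₂.assoc]

/-- To verify an identity of left-symmetric type on a tensor product, it suffices to check it on
tensors of homogeneous elements. -/
lemma leftSym_of_tmul {A B A' B' : ConformalProduct (M ⊗[ℂ[X]] N)} (lam mu : ℂ)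
    (h : ∀ (i₁ i₂ j₁ j₂ k₁ k₂ : ZMod 2) (a₁ b₁ c₁ : M) (a₂ b₂ c₂ : N),
      a₁ ∈ S.grade i₁ → a₂ ∈ T.grade i₂ → b₁ ∈ S.grade j₁ → b₂ ∈ T.grade j₂ →
      c₁ ∈ S.grade k₁ → c₂ ∈ T.grade k₂ →
      A.mul (lam + mu) (B.mul lam (a₁ ⊗ₜ a₂) (b₁ ⊗ₜ b₂)) (c₁ ⊗ₜ c₂) -
          A'.mul lam (a₁ ⊗ₜ a₂) (B'.mul mu (b₁ ⊗ₜ b₂) (c₁ ⊗ₜ c₂)) =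
        sgn (i₁ + i₂) (j₁ + j₂) •
          (A.mul (lam + mu) (B.mul mu (b₁ ⊗ₜ b₂) (a₁ ⊗ₜ a₂)) (c₁ ⊗ₜ c₂) -
            A'.mul mu (b₁ ⊗ₜ b₂) (B'.mul lam (a₁ ⊗ₜ a₂) (c₁ ⊗ₜ c₂))))
    {i j : ZMod 2} {x y : M ⊗[ℂ[X]] N} (hx : x ∈ tensorGrade S T i) (hy : y ∈ tensorGrade S T j)
    (z : M ⊗[ℂ[X]] N) :
    A.mul (lam + mu) (B.mul lam x y) z - A'.mul lam x (B'.mul mu y z) =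
      sgn i j • (A.mul (lam + mu) (B.mul mu y x) z - A'.mul mu y (B'.mul lam x z)) := by
  simp only [ConformalProduct.mul_eq_evalAt] at h ⊢
  refine eqOn_tensorGrade_bilinear
    (F := (B.evalAt (C lam)).compr₂ ((A.evalAt (C (lam + mu))).flip z) -
      (A'.evalAt (C lam)).compl₂ ((B'.evalAt (C mu)).flip z))
    (G := sgn i j • ((B.evalAt (C mu)).compr₂ ((A.evalAt (C (lam + mu))).flip z) -
      (A'.evalAt (C mu)).compl₂ ((B'.evalAt (C lam)).flip z)).flip) ?_ hx hy
  rintro i₁ i₂ j₁ j₂ a₁ b₁ a₂ b₂ rfl rfl ha₁ ha₂ hb₁ hb₂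
  set a := a₁ ⊗ₜ[ℂ[X]] a₂
  set b := b₁ ⊗ₜ[ℂ[X]] b₂
  exact LinearMap.congr_fun (homogeneous_tensor_hom_ext S T
    (f := A.evalAt (C (lam + mu)) (B.evalAt (C lam) a b) -
      A'.evalAt (C lam) a ∘ₗ B'.evalAt (C mu) b)
    (g := sgn (i₁ + i₂) (j₁ + j₂) • (A.evalAt (C (lam + mu)) (B.evalAt (C mu) b a) -
      A'.evalAt (C mu) b ∘ₗ B'.evalAt (C lam) a)) fun k₁ k₂ c₁ c₂ hc₁ hc₂ =>
    h i₁ i₂ j₁ j₂ k₁ k₂ a₁ b₁ c₁ a₂ b₂ c₂ ha₁ ha₂ hb₁ hb₂ hc₁ hc₂) z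

variable (h₁ : IsPreLiePoisson S m₁ p₁) (h₂ : IsPreLiePoisson T m₂ p₂)

/-- The commutative associative `λ`-product of the tensor product. -/
def tensorComm : ConformalProduct (M ⊗[ℂ[X]] N) :=
  tensorLambda h₁.commAssoc.toIsLambdaProduct h₂.commAssoc.toIsLambdaProduct

/-- The left-symmetric `λ`-product of the tensor product. -/
def tensorPreLie : ConformalProduct (M ⊗[ℂ[X]] N) :=
  (tensorLambda h₁.leftSymmetric.toIsLambdaProduct h₂.commAssoc.toIsLambdaProduct).add
    (tensorLambda h₁.commAssoc.toIsLambdaProduct h₂.leftSymmetric.toIsLambdaProduct)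

lemma isLeftSymmetric_tensorPreLie :
    IsLeftSymmetric (tensorSuperModule S T) (tensorPreLie h₁ h₂) where
  toIsLambdaProduct := (isLambdaProduct_tensorLambda _ _).add (isLambdaProduct_tensorLambda _ _)
  leftSym i j x y hx hy z lam mu := by
    refine leftSym_of_tmul lam mu (fun i₁ i₂ j₁ j₂ k₁ k₂ a₁ b₁ c₁ a₂ b₂ c₂ ha₁ ha₂ hb₁ hb₂ hc₁ hc₂
      => ?_) hx hy z
    simp only [tensorPreLie, ConformalProduct.add_mul, ConformalProduct.mul_add_left,
      ConformalProduct.mul_add_right,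
      tensorLambda_mul_mul_left _ _ _ _ _ _ a₁ c₂ ha₂ hb₁ hb₂ hc₁,
      tensorLambda_mul_mul_left _ _ _ _ _ _ b₁ c₂ hb₂ ha₁ ha₂ hc₁,
      tensorLambda_mul_mul_right _ _ _ _ _ _ a₁ c₂ ha₂ hb₁ hb₂ hc₁,
      tensorLambda_mul_mul_right _ _ _ _ _ _ b₁ c₂ hb₂ ha₁ ha₂ hc₁,
      ← smul_add, ← smul_sub, smul_smul, sgn_mul_tripleSgn_swap]
    rw [sub_eq_iff_eq_add.1 (h₁.leftSymmetric.leftSym _ _ _ _ ha₁ hb₁ c₁ lam mu),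
      sub_eq_iff_eq_add.1 (h₂.leftSymmetric.leftSym _ _ _ _ ha₂ hb₂ c₂ lam mu),
      sub_eq_iff_eq_add.1 (h₁.compat₂ _ _ _ _ ha₁ hb₁ c₁ lam mu),
      sub_eq_iff_eq_add.1 (h₂.compat₂ _ _ _ _ ha₂ hb₂ c₂ lam mu),
      ← h₁.commAssoc.assoc, ← h₂.commAssoc.assoc, h₁.comm_mul_mul, h₂.comm_mul_mul,
      h₁.compat₁, h₂.compat₁, h₁.comm_preLie_mul, h₂.comm_preLie_mul,
      h₁.commAssoc.mul_left_comm ha₁ hb₁, h₂.commAssoc.mul_left_comm ha₂ hb₂,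
      h₁.comm_preLie_left_comm ha₁ hb₁, h₂.comm_preLie_left_comm ha₂ hb₂]
    simp only [TensorProduct.add_tmul, TensorProduct.tmul_add, TensorProduct.sub_tmul,
      TensorProduct.tmul_sub, ← TensorProduct.smul_tmul', TensorProduct.tmul_smul]
    module

lemma isPreLiePoisson_tensor :
    IsPreLiePoisson (tensorSuperModule S T) (tensorComm h₁ h₂) (tensorPreLie h₁ h₂) where
  commAssoc := isCommAssoc_tensorLambda h₁.commAssoc h₂.commAssoc
  leftSymmetric := isLeftSymmetric_tensorPreLie h₁ h₂
  compat₁ lam mu x y z := by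
    set m := tensorComm h₁ h₂ with hm
    set p := tensorPreLie h₁ h₂ with hp
    simp only [ConformalProduct.mul_eq_evalAt]
    refine LinearMap.congr_fun (LinearMap.congr_fun₂ (homogeneous_tensor_bilinear_ext S T
      (F := (m.evalAt (C lam)).compr₂ (p.evalAt (C (lam + mu))))
      (G := nestRight (m.evalAt (C lam)) (p.evalAt (C mu)))
      fun i₁ i₂ j₁ j₂ a₁ b₁ a₂ b₂ ha₁ ha₂ hb₁ hb₂ =>
        homogeneous_tensor_hom_ext S T fun k₁ k₂ c₁ c₂ hc₁ hc₂ => ?_) x y) z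
    simp only [nestRight_apply, LinearMap.compr₂_apply, ← ConformalProduct.mul_eq_evalAt, hm, hp]
    simp only [tensorComm, tensorPreLie, ConformalProduct.add_mul, ConformalProduct.mul_add_right,
      tensorLambda_mul_mul_left _ _ _ _ _ _ a₁ c₂ ha₂ hb₁ hb₂ hc₁,
      tensorLambda_mul_mul_right _ _ _ _ _ _ a₁ c₂ ha₂ hb₁ hb₂ hc₁,
      h₁.compat₁, h₂.compat₁, h₁.commAssoc.assoc, h₂.commAssoc.assoc]
  compat₂ i j x y hx hy z lam mu := by
    refine leftSym_of_tmul lam mu (fun i₁ i₂ j₁ j₂ k₁ k₂ a₁ b₁ c₁ a₂ b₂ c₂ ha₁ ha₂ hb₁ hb₂ hc₁ hc₂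
      => ?_) hx hy z
    simp only [tensorComm, tensorPreLie, ConformalProduct.add_mul, ConformalProduct.mul_add_left,
      tensorLambda_mul_mul_left _ _ _ _ _ _ a₁ c₂ ha₂ hb₁ hb₂ hc₁,
      tensorLambda_mul_mul_left _ _ _ _ _ _ b₁ c₂ hb₂ ha₁ ha₂ hc₁,
      tensorLambda_mul_mul_right _ _ _ _ _ _ a₁ c₂ ha₂ hb₁ hb₂ hc₁,
      tensorLambda_mul_mul_right _ _ _ _ _ _ b₁ c₂ hb₂ ha₁ ha₂ hc₁,
      ← smul_add, ← smul_sub, smul_smul, sgn_mul_tripleSgn_swap]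
    rw [sub_eq_iff_eq_add.1 (h₁.compat₂ _ _ _ _ ha₁ hb₁ c₁ lam mu),
      sub_eq_iff_eq_add.1 (h₂.compat₂ _ _ _ _ ha₂ hb₂ c₂ lam mu),
      ← h₁.commAssoc.assoc, ← h₂.commAssoc.assoc, h₁.comm_mul_mul, h₂.comm_mul_mul,
      h₁.commAssoc.mul_left_comm ha₁ hb₁, h₂.commAssoc.mul_left_comm ha₂ hb₂]
    simp only [TensorProduct.add_tmul, TensorProduct.tmul_add, TensorProduct.sub_tmul,
      TensorProduct.tmul_sub, ← TensorProduct.smul_tmul', TensorProduct.tmul_smul]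
    module

end TensorIdentities

/-- the tensor product over `ℂ[∂]` of two pre-Lie Poisson conformal
superalgebras, with `(a₁ ⊗ a₂) ∘_λ (b₁ ⊗ b₂) = (-1)^{|a₂||b₁|} (a₁ ∘¹_λ b₁) ⊗ (a₂ ∘²_λ b₂)`
and `(a₁ ⊗ a₂) ∗_λ (b₁ ⊗ b₂) = (-1)^{|a₂||b₁|} ((a₁ ∗¹_λ b₁) ⊗ (a₂ ∘²_λ b₂) +
(a₁ ∘¹_λ b₁) ⊗ (a₂ ∗²_λ b₂))`, is again a pre-Lie Poisson conformal superalgebra. -/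
theorem statement_16
    {L₁ : Type*} [AddCommGroup L₁] [Module ℂ L₁] [Module (Polynomial ℂ) L₁]
    [IsScalarTower ℂ (Polynomial ℂ) L₁]
    {L₂ : Type*} [AddCommGroup L₂] [Module ℂ L₂] [Module (Polynomial ℂ) L₂]
    [IsScalarTower ℂ (Polynomial ℂ) L₂]
    (S₁ : SuperModule L₁) (m₁ p₁ : ConformalProduct L₁) (h₁ : IsPreLiePoisson S₁ m₁ p₁)
    (S₂ : SuperModule L₂) (m₂ p₂ : ConformalProduct L₂) (h₂ : IsPreLiePoisson S₂ m₂ p₂) :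
    ∃ (S : SuperModule (L₁ ⊗[Polynomial ℂ] L₂))
      (m p : ConformalProduct (L₁ ⊗[Polynomial ℂ] L₂)),
      (∀ k : ZMod 2, S.grade k = Submodule.span ℂ
        {t : L₁ ⊗[Polynomial ℂ] L₂ | ∃ (i j : ZMod 2) (a : L₁) (b : L₂),
          i + j = k ∧ a ∈ S₁.grade i ∧ b ∈ S₂.grade j ∧ t = a ⊗ₜ[Polynomial ℂ] b}) ∧
      (∀ (i₂ j₁ : ZMod 2) (a₁ b₁ : L₁) (a₂ b₂ : L₂),
        a₂ ∈ S₂.grade i₂ → b₁ ∈ S₁.grade j₁ → ∀ lam : ℂ,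
          m.mul lam (a₁ ⊗ₜ[Polynomial ℂ] a₂) (b₁ ⊗ₜ[Polynomial ℂ] b₂) =
            sgn i₂ j₁ • (m₁.mul lam a₁ b₁ ⊗ₜ[Polynomial ℂ] m₂.mul lam a₂ b₂)) ∧
      (∀ (i₂ j₁ : ZMod 2) (a₁ b₁ : L₁) (a₂ b₂ : L₂),
        a₂ ∈ S₂.grade i₂ → b₁ ∈ S₁.grade j₁ → ∀ lam : ℂ,
          p.mul lam (a₁ ⊗ₜ[Polynomial ℂ] a₂) (b₁ ⊗ₜ[Polynomial ℂ] b₂) =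
            sgn i₂ j₁ • (p₁.mul lam a₁ b₁ ⊗ₜ[Polynomial ℂ] m₂.mul lam a₂ b₂
              + m₁.mul lam a₁ b₁ ⊗ₜ[Polynomial ℂ] p₂.mul lam a₂ b₂)) ∧
      IsPreLiePoisson S m p := by
  refine ⟨tensorSuperModule S₁ S₂, tensorComm h₁ h₂, tensorPreLie h₁ h₂, fun _ => rfl,
    fun i₂ j₁ a₁ b₁ a₂ b₂ ha₂ hb₁ lam => tensorLambda_mul_tmul _ _ lam a₁ b₂ ha₂ hb₁,
    fun i₂ j₁ a₁ b₁ a₂ b₂ ha₂ hb₁ lam => ?_, isPreLiePoisson_tensor h₁ h₂⟩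
  rw [tensorPreLie, ConformalProduct.add_mul, tensorLambda_mul_tmul _ _ lam a₁ b₂ ha₂ hb₁,
    tensorLambda_mul_tmul _ _ lam a₁ b₂ ha₂ hb₁, smul_add]

end TPCSAFormal
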